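/- arXiv:2211.15737 — 2 statements merged into one kernel-verified Lean document; each statement's English description precedes it below -/
import Mathlib

section
/- Let 𝒳 ⊆ ℝ^d be nonempty, f = (f_1, …, f_p) : ℝ^d → ℝ^p with p ≥ 2, and 𝒴 = f(𝒳). If 𝒴 + ℝ^p_+ is convex (where ℝ^p_+ = {z ∈ ℝ^p : z_i ≥ 0 for all i}) and x̄ ∈ 𝒳 is efficient, then there exists a weighting vector λ̄ ∈ Λ₀ (i.e., λ̄_i ≥ 0 for all i and ∑_i λ̄_i = 1) such that x̄ minimizes f_{λ̄}(x) = ∑_{i=1}^p λ̄_i f_i(x) over 𝒳. -/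
open scoped Pointwise

/-- If `𝒴 + ℝ^p_+` is convex and `x̄ ∈ 𝒳` is efficient, then there exists a
weighting vector `λ̄ ∈ Λ₀` such that `x̄` minimizes the weighted sum `f_λ̄` over `𝒳`. -/
theorem efficient_is_weighted_sum_min_of_convex
    {d p : ℕ} (hp : 2 ≤ p)
    (X : Set (Fin d → ℝ)) (hX : X.Nonempty)
    (f : (Fin d → ℝ) → (Fin p → ℝ))
    (hconv : Convex ℝ ((f '' X) + {z : Fin p → ℝ | ∀ i, 0 ≤ z i}))
    (xbar : Fin d → ℝ) (hxbar : xbar ∈ X)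
    (heff : ¬ ∃ x ∈ X, (∀ i, f x i ≤ f xbar i) ∧ f x ≠ f xbar) :
    ∃ lam : Fin p → ℝ, (∀ i, 0 ≤ lam i) ∧ (∑ i, lam i = 1) ∧
      ∀ x ∈ X, ∑ i, lam i * f xbar i ≤ ∑ i, lam i * f x i := by
  have hT : ∀ x ∈ X, ∀ z : Fin p → ℝ, (∀ i, 0 ≤ z i) →
      f x + z ∈ (f '' X) + {z : Fin p → ℝ | ∀ i, 0 ≤ z i} :=
    fun x hx z hz => Set.add_mem_add (Set.mem_image_of_mem f hx) hz
  have i0 : Fin p := ⟨0, by omega⟩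
  have hdisj : Disjoint (Set.pi Set.univ (fun i => Set.Iio (f xbar i)))
      ((f '' X) + {z : Fin p → ℝ | ∀ i, 0 ≤ z i}) := by
    rw [Set.disjoint_left]
    rintro a ha hb
    obtain ⟨_, ⟨x, hx, rfl⟩, z, hz, rfl⟩ := Set.mem_add.1 hb
    have h : ∀ i, f x i < f xbar i := by
      intro i
      have h1 : f x i + z i < f xbar i := ha i (Set.mem_univ i)
      have h2 : 0 ≤ z i := hz i
      linarith
    refine heff ⟨x, hx, fun i => (h i).le, fun he => ?_⟩
    have h3 := h i0
    rw [he] at h3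
    exact lt_irrefl _ h3
  obtain ⟨g, u, hS, hgT⟩ := geometric_hahn_banach_open
    (convex_pi (fun i _ => convex_Iio (𝕜 := ℝ) (f xbar i)))
    (isOpen_set_pi Set.finite_univ (fun i _ => isOpen_Iio)) hconv hdisj
  have hg : ∀ y, g y = ∑ i, y i * g (Pi.single i 1) := by
    intro y
    conv_lhs => rw [pi_eq_sum_univ' y]
    simp [map_sum, Pi.single_apply, Pi.single, Function.update]
  have hε : ∀ ε : ℝ, 0 < ε → g (f xbar) - ε * g 1 < u := by
    intro ε h
    have := hS (f xbar - ε • (1 : Fin p → ℝ)) (by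
      intro i _
      simp [h])
    simpa using this
  have hX' : ∀ x ∈ X, u ≤ g (f x) := by
    intro x hx
    simpa using hgT _ (hT x hx 0 (fun i => le_rfl))
  have hc := hX' xbar hxbar
  have h1 : 0 < g 1 := by
    have := hε 1 one_pos
    linarith
  have hu : g (f xbar) ≤ u := by
    by_contra! hlt
    have := hε ((g (f xbar) - u) / g 1) (div_pos (by linarith) h1)
    rw [div_mul_cancel₀ _ h1.ne'] at this
    linarith
  have hsum : ∀ y : Fin p → ℝ, ∑ i, g (Pi.single i 1) / g 1 * y i = g y / g 1 := by
    intro y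
    rw [hg y, Finset.sum_div]
    exact Finset.sum_congr rfl (fun i _ => by ring)
  refine ⟨fun i => g (Pi.single i 1) / g 1, fun i => div_nonneg ?_ h1.le, ?_, fun x hx => ?_⟩
  · have h := hgT _ (hT xbar hxbar (Pi.single i 1) (fun j => by
      by_cases hj : j = i
      · subst hj; simp
      · simp [hj]))
    rw [map_add] at h
    linarith
  · have h := hsum 1
    rw [div_self h1.ne'] at h
    simpa using h
  · rw [hsum, hsum]
    exact div_le_div_of_nonneg_right (hu.trans (hX' x hx)) h1.le
end

section
/- Let p ≥ 1, M > 0, let B = {x ∈ ℝ^d : |x| ≤ M} be the closed ball of radius M, and let f = (f_1, …, f_p) : ℝ^d → ℝ^p satisfy max_i |f_i(y)| ≤ F for all y ∈ B, where F ≥ 0. For μ ∈ ℝ^p define f_μ(x) = (∑_{i=1}^p e^{μ_i} f_i(x)) / (∑_{i=1}^p e^{μ_i}). Then for all x ∈ B and all μ, μ̂ ∈ ℝ^p with Euclidean norms |μ| ≤ M and |μ̂| ≤ M, one has |f_μ(x) − f_{μ̂}(x)| ≤ (1 + 1/p) · F · e^{2M} · |μ − μ̂|. -/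
theorem exp_lip_aux (a b M : ℝ) (ha : a ≤ M) (hb : b ≤ M) :
    |Real.exp a - Real.exp b| ≤ Real.exp M * |a - b| := by
  have key : ∀ u v : ℝ, u ≤ M → Real.exp u - Real.exp v ≤ Real.exp M * |u - v| := by
    intro u v hu
    have h1 := Real.add_one_le_exp (v - u)
    have h2 : Real.exp v = Real.exp u * Real.exp (v - u) := by
      rw [← Real.exp_add]; congr 1; ring
    have h3 : Real.exp u ≤ Real.exp M := Real.exp_le_exp.mpr hu
    have h4 := le_abs_self (u - v)
    calc Real.exp u - Real.exp v ≤ Real.exp u * (u - v) := by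
          rw [h2]; nlinarith [Real.exp_pos u]
      _ ≤ Real.exp u * |u - v| := by gcongr
      _ ≤ _ := by gcongr
  rw [abs_le]
  have h1 := key a b ha
  have h2 := key b a hb
  rw [abs_sub_comm b a] at h2
  constructor <;> linarith

/-- Lipschitz estimate in the weight `μ` for the exponentially reparameterized
scalarization `f_μ(x) = (∑ i e^{μ_i} f_i(x)) / (∑ i e^{μ_i})`:
`|f_μ(x) − f_μ̂(x)| ≤ (1 + 1/p) F e^{2M} |μ − μ̂|` for `‖x‖ ≤ M`, `|μ|, |μ̂| ≤ M`. -/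
theorem scalarization_lipschitz_in_weights
    {d p : ℕ} (hp : 1 ≤ p) (M F : ℝ) (hM : 0 < M) (hF : 0 ≤ F)
    (f : EuclideanSpace ℝ (Fin d) → (Fin p → ℝ))
    (hfb : ∀ y : EuclideanSpace ℝ (Fin d), ‖y‖ ≤ M → ∀ i, |f y i| ≤ F)
    (x : EuclideanSpace ℝ (Fin d)) (hx : ‖x‖ ≤ M)
    (μ μ' : EuclideanSpace ℝ (Fin p)) (hμ : ‖μ‖ ≤ M) (hμ' : ‖μ'‖ ≤ M) :
    |(∑ i, Real.exp (μ i) * f x i) / (∑ i, Real.exp (μ i)) -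
        (∑ i, Real.exp (μ' i) * f x i) / (∑ i, Real.exp (μ' i))| ≤
      (1 + 1 / (p : ℝ)) * F * Real.exp (2 * M) * ‖μ - μ'‖ := by
  have hc : ∀ (v : EuclideanSpace ℝ (Fin p)) (i : Fin p), |v i| ≤ ‖v‖ := fun v i => by
    simpa using PiLp.norm_apply_le v i
  have hp0 : (0 : ℝ) < p := by exact_mod_cast hp
  haveI : Nonempty (Fin p) := ⟨⟨0, hp⟩⟩
  set S := ∑ i, Real.exp (μ i) with hS
  set S' := ∑ i, Real.exp (μ' i) with hS'
  have hS'0 : 0 < S' := Finset.sum_pos (fun i _ => Real.exp_pos _) Finset.univ_nonempty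
  have hSlow : (p : ℝ) * Real.exp (-M) ≤ S := by
    have : ∑ _i : Fin p, Real.exp (-M) ≤ S := by
      apply Finset.sum_le_sum
      intro i _
      apply Real.exp_le_exp.mpr
      have := (abs_le.mp ((hc μ i).trans hμ)).1
      exact this
    simpa using this
  have hS0 : 0 < S := lt_of_lt_of_le (by positivity) hSlow
  set g := (∑ i, Real.exp (μ' i) * f x i) / S' with hg
  have hgF : |g| ≤ F := by
    rw [hg, abs_div, abs_of_pos hS'0, div_le_iff₀ hS'0, hS', Finset.mul_sum]
    refine (Finset.abs_sum_le_sum_abs _ _).trans (Finset.sum_le_sum fun i _ => ?_)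
    rw [abs_mul, abs_of_pos (Real.exp_pos _), mul_comm]
    gcongr
    exact hfb x hx i
  have hgS : g * S' = ∑ i, Real.exp (μ' i) * f x i := by
    rw [hg]; field_simp
  have hid : (∑ i, Real.exp (μ i) * f x i) / S - g
      = (∑ i, (Real.exp (μ i) - Real.exp (μ' i)) * (f x i - g)) / S := by
    have : ∑ i, (Real.exp (μ i) - Real.exp (μ' i)) * (f x i - g)
        = ∑ i, Real.exp (μ i) * f x i - g * S := by
      have e : ∀ i, (Real.exp (μ i) - Real.exp (μ' i)) * (f x i - g)
        = Real.exp (μ i) * f x i - Real.exp (μ' i) * f x i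
          - g * Real.exp (μ i) + g * Real.exp (μ' i) := fun i => by ring
      simp only [e, Finset.sum_add_distrib, Finset.sum_sub_distrib, ← Finset.mul_sum]
      rw [← hgS]; ring
    rw [this]; field_simp
  have hl1 : ∑ i, |μ i - μ' i| ≤ √(p : ℝ) * ‖μ - μ'‖ := by
    rw [EuclideanSpace.norm_eq, ← Real.sqrt_mul hp0.le]
    apply Real.le_sqrt_of_sq_le
    have := sq_sum_le_card_mul_sum_sq (s := Finset.univ) (f := fun i : Fin p => |μ i - μ' i|)
    simpa using this
  have hnum : |∑ i, (Real.exp (μ i) - Real.exp (μ' i)) * (f x i - g)|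
      ≤ 2 * F * Real.exp M * (√(p : ℝ) * ‖μ - μ'‖) := by
    refine le_trans ?_ (mul_le_mul_of_nonneg_left hl1 (by positivity))
    rw [Finset.mul_sum]
    refine (Finset.abs_sum_le_sum_abs _ _).trans (Finset.sum_le_sum fun i _ => ?_)
    rw [abs_mul]
    have h1 := exp_lip_aux (μ i) (μ' i) M ((le_abs_self _).trans ((hc μ i).trans hμ))
      ((le_abs_self _).trans ((hc μ' i).trans hμ'))
    have h2 : |f x i - g| ≤ 2 * F := by
      have := abs_sub (f x i) g
      have := hfb x hx i
      linarith
    calc _ ≤ (Real.exp M * |μ i - μ' i|) * (2 * F) := by gcongr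
      _ = _ := by ring
  have hsq : √(p : ℝ) * √(p : ℝ) = p := Real.mul_self_sqrt hp0.le
  have hee : Real.exp (2 * M) * Real.exp (-M) = Real.exp M := by
    rw [← Real.exp_add]; congr 1; ring
  rw [hid, abs_div, abs_of_pos hS0, div_le_iff₀ hS0]
  refine hnum.trans ?_
  calc 2 * F * Real.exp M * (√(p : ℝ) * ‖μ - μ'‖)
      = (2 * √(p : ℝ)) * (F * Real.exp M * ‖μ - μ'‖) := by ring
    _ ≤ (p + 1) * (F * Real.exp M * ‖μ - μ'‖) := by
        gcongr
        nlinarith [sq_nonneg (√(p : ℝ) - 1)]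
    _ = (1 + 1 / (p : ℝ)) * F * Real.exp (2 * M) * ‖μ - μ'‖ * (p * Real.exp (-M)) := by
        rw [← hee]; field_simp
    _ ≤ _ := by gcongr
end
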